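/- arXiv:math/0305359 — 3 statements merged into one kernel-verified Lean document; each statement's English description precedes it below -/
import Mathlib

section
/- Let P and Q be nontrivial projections on a complex Hilbert space H such that ‖P + A‖_v = ‖Q + A‖_v holds for every finite-rank self-adjoint operator A. Then P = Q. -/
open scoped InnerProductSpace

variable {H : Type*} [NormedAddCommGroup H] [InnerProductSpace ℂ H] [CompleteSpace H]

/-- Variance of a bounded observable `T` at a vector `φ`. -/
noncomputable def observableVar (T : H →L[ℂ] H) (φ : H) : ℝ :=
  (⟪T (T φ), φ⟫_ℂ).re - ((⟪T φ, φ⟫_ℂ).re) ^ 2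

/-- Maximal deviation of a bounded observable `T`. -/
noncomputable def maxDev (T : H →L[ℂ] H) : ℝ :=
  ⨆ φ : {x : H // ‖x‖ = 1}, Real.sqrt (observableVar T φ)

open ContinuousLinearMap InnerProductSpace

set_option linter.unusedSectionVars false

lemma observableVar_eq_norm_sq_sub {T : H →L[ℂ] H} (hT : IsSelfAdjoint T) (φ : H) :
    observableVar T φ = ‖T φ‖ ^ 2 - (⟪T φ, φ⟫_ℂ).re ^ 2 := by
  have h1 : ⟪T (T φ), φ⟫_ℂ = ⟪T φ, T φ⟫_ℂ := hT.isSymmetric (T φ) φ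
  have h2 : (⟪T φ, T φ⟫_ℂ).re = ‖T φ‖ ^ 2 := inner_self_eq_norm_sq (𝕜 := ℂ) (T φ)
  rw [observableVar, h1, h2]

lemma sqrt_observableVar_le_maxDev {T : H →L[ℂ] H} (hT : IsSelfAdjoint T) {φ : H}
    (hφ : ‖φ‖ = 1) : √(observableVar T φ) ≤ maxDev T := by
  refine le_ciSup (f := fun φ : {x : H // ‖x‖ = 1} => √(observableVar T φ))
    ⟨‖T‖, ?_⟩ ⟨φ, hφ⟩
  rintro _ ⟨⟨ψ, hψ⟩, rfl⟩
  have h1 := T.le_opNorm ψ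
  rw [hψ, mul_one] at h1
  refine Real.sqrt_le_iff.2 ⟨norm_nonneg _, ?_⟩
  dsimp only
  rw [observableVar_eq_norm_sq_sub hT]
  nlinarith [norm_nonneg (T ψ), sq_nonneg (⟪T ψ, ψ⟫_ℂ).re]

/-- Popoviciu's inequality for bounded observables. -/
lemma maxDev_le_of_quadraticForm_bounds {T : H →L[ℂ] H} (hT : IsSelfAdjoint T) {m M : ℝ}
    (hmM : m ≤ M) (hm : ∀ x, m * ‖x‖ ^ 2 ≤ (⟪T x, x⟫_ℂ).re)
    (hM : ∀ x, (⟪T x, x⟫_ℂ).re ≤ M * ‖x‖ ^ 2) : maxDev T ≤ (M - m) / 2 := by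
  set c : ℝ := (M + m) / 2 with hc
  set S : H →L[ℂ] H := T - (c : ℂ) • 1 with hS
  have hSsa : IsSelfAdjoint S :=
    hT.sub (IsSelfAdjoint.smul (Complex.conj_ofReal c) (IsSelfAdjoint.one (H →L[ℂ] H)))
  have hre (x : H) : (⟪S x, x⟫_ℂ).re = (⟪T x, x⟫_ℂ).re - c * ‖x‖ ^ 2 := by
    simp [hS, inner_self_eq_norm_sq_to_K, ← Complex.ofReal_pow]
  have hnorm : ‖S‖ ≤ (M - m) / 2 := by
    rw [norm_eq_iSup_rayleighQuotient S hSsa.isSymmetric]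
    refine ciSup_le fun x => ?_
    rw [rayleighQuotient, abs_div, abs_of_nonneg (sq_nonneg ‖x‖)]
    refine div_le_of_le_mul₀ (sq_nonneg _) (by linarith) ?_
    rw [reApplyInnerSelf_apply]
    change |(⟪S x, x⟫_ℂ).re| ≤ _
    rw [hre, abs_le]
    constructor <;> nlinarith [hm x, hM x]
  refine Real.iSup_le (fun ⟨φ, hφ⟩ => ?_) (by linarith)
  refine Real.sqrt_le_iff.2 ⟨by linarith, ?_⟩
  dsimp only
  rw [observableVar_eq_norm_sq_sub hT]
  have h1 : ‖S φ‖ ^ 2 = ‖T φ‖ ^ 2 - 2 * c * (⟪T φ, φ⟫_ℂ).re + c ^ 2 := by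
    have : S φ = T φ - (c : ℂ) • φ := by simp [hS]
    rw [this, @norm_sub_sq ℂ, norm_smul, hφ, inner_smul_right]
    simp
    ring
  have h2 := S.le_opNorm φ
  rw [hφ, mul_one] at h2
  nlinarith [norm_nonneg (S φ), sq_nonneg ((⟪T φ, φ⟫_ℂ).re - c)]

lemma exists_eq_smul_one_of_maxDev_eq_zero {T : H →L[ℂ] H} (hT : IsSelfAdjoint T)
    (h0 : maxDev T = 0) : ∃ c : ℂ, T = c • 1 := by
  have key (x : H) : ∃ d : ℂ, T x = d • x := by
    rcases eq_or_ne x 0 with rfl | hx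
    · exact ⟨0, by simp⟩
    set φ : H := ((‖x‖⁻¹ : ℝ) : ℂ) • x with hφd
    have hφ : ‖φ‖ = 1 := by simp [hφd, norm_smul, hx]
    have hv : observableVar T φ ≤ 0 :=
      Real.sqrt_eq_zero'.1 (le_antisymm (h0 ▸ sqrt_observableVar_le_maxDev hT hφ)
        (Real.sqrt_nonneg _))
    set a : ℝ := (⟪T φ, φ⟫_ℂ).re with ha
    rw [observableVar_eq_norm_sq_sub hT] at hv
    have h1 : ‖T φ - (a : ℂ) • φ‖ ^ 2 = ‖T φ‖ ^ 2 - a ^ 2 := by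
      rw [@norm_sub_sq ℂ, norm_smul, hφ, inner_smul_right]
      simp [← ha]
      ring
    have h2 : T φ = (a : ℂ) • φ := by
      rw [← sub_eq_zero, ← norm_eq_zero]
      exact pow_eq_zero_iff two_ne_zero |>.1 (le_antisymm (by linarith) (sq_nonneg _))
    refine ⟨a, ?_⟩
    have hx' : x = (‖x‖ : ℂ) • φ := by
      rw [hφd, smul_smul]
      simp [hx]
    rw [hx', map_smul, h2, smul_comm]
  obtain ⟨c, hc⟩ := LinearMap.exists_eq_smul_id_of_forall_notLinearIndependent
    (f := (T : H →ₗ[ℂ] H)) (fun x hli => by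
      obtain ⟨d, hd⟩ := key x
      have := (LinearIndependent.pair_iff.1 hli) d (-1) (by simp [hd])
      simp at this)
  exact ⟨c, by ext x; simpa using congrArg (fun f => f x) hc⟩

lemma IsIdempotentElem.eq_of_sub_eq_smul_one {P Q : H →L[ℂ] H} (hP2 : IsIdempotentElem P)
    (hQ2 : IsIdempotentElem Q) (hP0 : P ≠ 0) (hP1 : P ≠ 1) {c : ℂ} (hc : Q - P = c • 1) :
    P = Q := by
  obtain ⟨x, hx⟩ := DFunLike.ne_iff.1 hP0
  obtain ⟨y, hy⟩ := DFunLike.ne_iff.1 hP1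
  have hQ : Q = P + c • 1 := by rw [← hc]; abel
  have hPP (z : H) : P (P z) = P z := congrArg (fun f => f z) hP2.eq
  have hz (z : H) : (2 * c) • P z = (c - c * c) • z := by
    have h1 : Q (Q z) = Q z := congrArg (fun f => f z) hQ2.eq
    simp only [hQ, add_apply, smul_apply, one_apply_eq_self, map_add, map_smul, hPP] at h1
    have h2 : P z + (2 * c) • P z + (c * c) • z = P z + c • z := by
      rw [← h1]; module
    rw [← sub_eq_zero] at h2 ⊢
    rw [← h2]; module
  have h1 : c * (1 + c) = 0 := by
    have h := hz (P x)
    rw [hPP, ← sub_eq_zero, ← sub_smul] at h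
    have := (smul_eq_zero.1 h).resolve_right hx
    linear_combination this
  have h2 : c - c * c = 0 := by
    have h := hz (y - P y)
    rw [map_sub, hPP, sub_self, smul_zero] at h
    exact (smul_eq_zero.1 h.symm).resolve_right (sub_ne_zero.2 (Ne.symm hy))
  have h3 : c = 0 := by linear_combination (h1 + h2) / 2
  rw [hQ, h3]; simp

lemma eq_of_maxDev_add_neg_eq {P Q : H →L[ℂ] H} (hP : IsSelfAdjoint P) (hP2 : IsIdempotentElem P)
    (hQ : IsSelfAdjoint Q) (hQ2 : IsIdempotentElem Q) (hP0 : P ≠ 0) (hP1 : P ≠ 1)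
    (h : maxDev (P + -P) = maxDev (Q + -P)) : P = Q := by
  have h0 : maxDev (Q - P) = 0 := by
    rw [← sub_eq_add_neg, ← sub_eq_add_neg, sub_self] at h
    rw [← h]
    simp [maxDev, observableVar]
  obtain ⟨c, hc⟩ := exists_eq_smul_one_of_maxDev_eq_zero (hQ.sub hP) h0
  exact hP2.eq_of_sub_eq_smul_one hQ2 hP0 hP1 hc

lemma re_inner_projection_apply_self {P : H →L[ℂ] H} (hP : IsSelfAdjoint P)
    (hP2 : IsIdempotentElem P) (x : H) : (⟪P x, x⟫_ℂ).re = ‖P x‖ ^ 2 := by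
  have h1 : ⟪P (P x), x⟫_ℂ = ⟪P x, P x⟫_ℂ := hP.isSymmetric (P x) x
  have hPP : P (P x) = P x := congrArg (fun f => f x) hP2.eq
  rw [hPP] at h1
  rw [h1]
  exact inner_self_eq_norm_sq (𝕜 := ℂ) (P x)

lemma norm_projection_apply_le {P : H →L[ℂ] H} (hP : IsSelfAdjoint P)
    (hP2 : IsIdempotentElem P) (x : H) : ‖P x‖ ≤ ‖x‖ := by
  have h1 := re_inner_projection_apply_self hP hP2 x
  have h2 : (⟪P x, x⟫_ℂ).re ≤ ‖P x‖ * ‖x‖ := re_inner_le_norm (𝕜 := ℂ) (P x) x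
  by_contra! h3
  nlinarith [norm_nonneg x, norm_nonneg (P x)]

lemma isSelfAdjoint_smul_rankOne_self (t : ℝ) (φ : H) :
    IsSelfAdjoint ((t : ℂ) • rankOne ℂ φ φ) := by
  refine IsSelfAdjoint.smul (Complex.conj_ofReal t) ?_
  rw [isSelfAdjoint_iff', adjoint_rankOne]

lemma re_inner_add_smul_rankOne (P : H →L[ℂ] H) (t : ℝ) (φ x : H) :
    (⟪(P + ((-t : ℝ) : ℂ) • rankOne ℂ φ φ) x, x⟫_ℂ).re
      = (⟪P x, x⟫_ℂ).re - t * ‖⟪φ, x⟫_ℂ‖ ^ 2 := by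
  simp only [add_apply, smul_apply, rankOne_apply, inner_add_left, inner_smul_left,
    Complex.conj_ofReal, RCLike.conj_mul]
  simp [← Complex.ofReal_pow]
  ring

lemma maxDev_add_smul_rankOne_le {P : H →L[ℂ] H} (hP : IsSelfAdjoint P)
    (hP2 : IsIdempotentElem P) {φ : H} (hφ : ‖φ‖ = 1) {δ : ℝ} (hδ : 0 < δ) :
    maxDev (P + ((-(1 + δ⁻¹) : ℝ) : ℂ) • rankOne ℂ φ φ)
      ≤ (1 - (‖P φ‖ ^ 2 - (1 + δ⁻¹) - δ)) / 2 := by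
  have hPφ := norm_projection_apply_le hP hP2 φ
  rw [hφ] at hPφ
  have hδ' : 0 < δ⁻¹ := inv_pos.2 hδ
  have hδδ : δ * δ⁻¹ = 1 := mul_inv_cancel₀ hδ.ne'
  have hp := norm_nonneg (P φ)
  refine maxDev_le_of_quadraticForm_bounds
    (hP.add (isSelfAdjoint_smul_rankOne_self _ φ)) (by nlinarith) (fun x => ?_) (fun x => ?_)
  · rw [re_inner_add_smul_rankOne, re_inner_projection_apply_self hP hP2]
    set α : ℂ := ⟪φ, x⟫_ℂ with hα
    set y : H := x - α • φ with hy
    have hxy : ‖x‖ ^ 2 = ‖α‖ ^ 2 + ‖y‖ ^ 2 := by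
      have hx : x = α • φ + y := by rw [hy]; abel
      have h0 : ⟪α • φ, y⟫_ℂ = 0 := by
        rw [hy, inner_smul_left, inner_sub_right, inner_smul_right, ← hα,
          inner_self_eq_norm_sq_to_K, hφ]
        simp
      have := norm_add_sq_eq_norm_sq_add_norm_sq_of_inner_eq_zero (α • φ) y h0
      rw [← hx, norm_smul, hφ, mul_one] at this
      nlinarith
    have hPx : ‖α‖ * ‖P φ‖ ≤ ‖P x‖ + ‖y‖ := by
      have h1 : α • P φ = P x - P y := by simp [hy]
      rw [← norm_smul, h1]
      exact (norm_sub_le _ _).trans (by gcongr; exact norm_projection_apply_le hP hP2 y)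
    have hα0 := norm_nonneg α
    have hy0 := norm_nonneg y
    have h1 : (‖α‖ * ‖P φ‖) ^ 2 - 2 * ‖α‖ * ‖y‖ ≤ ‖P x‖ ^ 2 := by
      have ha : 0 ≤ ‖α‖ * ‖P φ‖ := by positivity
      have ha' : ‖α‖ * ‖P φ‖ ≤ ‖α‖ := mul_le_of_le_one_right hα0 hPφ
      generalize ‖α‖ * ‖P φ‖ = a at *
      have : a * ‖y‖ ≤ ‖α‖ * ‖y‖ := by gcongr
      rcases le_total a ‖y‖ with h | h
      · nlinarith [sq_nonneg ‖P x‖]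
      · nlinarith [norm_nonneg (P x)]
    have h2 : 2 * ‖α‖ * ‖y‖ ≤ δ * ‖α‖ ^ 2 + δ⁻¹ * ‖y‖ ^ 2 := by
      have : 0 ≤ δ⁻¹ * (δ * ‖α‖ - ‖y‖) ^ 2 := by positivity
      have h3 : δ⁻¹ * (δ * ‖α‖ - ‖y‖) ^ 2 = δ * ‖α‖ ^ 2 + δ⁻¹ * ‖y‖ ^ 2 - 2 * ‖α‖ * ‖y‖ := by
        field_simp
        ring
      linarith
    have h4 : 0 ≤ (1 - ‖P φ‖ ^ 2 + δ) * ‖y‖ ^ 2 :=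
      mul_nonneg (by nlinarith) (sq_nonneg _)
    rw [hxy]
    nlinarith
  · rw [re_inner_add_smul_rankOne, re_inner_projection_apply_self hP hP2]
    have h1 := norm_projection_apply_le hP hP2 x
    have h2 : 0 ≤ (1 + δ⁻¹) * ‖⟪φ, x⟫_ℂ‖ ^ 2 := by positivity
    nlinarith [norm_nonneg (P x)]

lemma exists_unit_fixed_inner_eq_zero {P : H →L[ℂ] H} (hP2 : IsIdempotentElem P)
    (hfin : ¬ FiniteDimensional ℂ (LinearMap.range (P : H →ₗ[ℂ] H))) (φ : H) :
    ∃ u : H, ‖u‖ = 1 ∧ P u = u ∧ ⟪φ, u⟫_ℂ = 0 := by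
  have hPP (z : H) : P (P z) = P z := congrArg (fun f => f z) hP2.eq
  by_contra! hcon
  refine hfin (FiniteDimensional.of_injective
    ((innerₛₗ ℂ φ).comp (LinearMap.range (P : H →ₗ[ℂ] H)).subtype)
    ((injective_iff_map_eq_zero _).2 ?_))
  rintro ⟨_, x, rfl⟩ hv
  by_contra hne
  have hx : P x ≠ 0 := fun h => hne (Subtype.ext h)
  have hv' : ⟪φ, P x⟫_ℂ = 0 := hv
  refine hcon (((‖P x‖⁻¹ : ℝ) : ℂ) • P x) ?_ ?_ ?_
  · simp [norm_smul, hx]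
  · rw [map_smul, hPP]
  · rw [inner_smul_right, hv', mul_zero]

lemma le_maxDev_add_smul_rankOne {P : H →L[ℂ] H} (hP : IsSelfAdjoint P)
    (hP2 : IsIdempotentElem P)
    (hfin : ¬ FiniteDimensional ℂ (LinearMap.range (P : H →ₗ[ℂ] H)))
    {φ : H} (hφ : ‖φ‖ = 1) (t : ℝ) :
    (1 - (‖P φ‖ ^ 2 - t)) / 2 ≤ maxDev (P + ((-t : ℝ) : ℂ) • rankOne ℂ φ φ) := by
  obtain ⟨u, hu, hPu, hφu⟩ := exists_unit_fixed_inner_eq_zero hP2 hfin φ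
  set T : H →L[ℂ] H := P + ((-t : ℝ) : ℂ) • rankOne ℂ φ φ with hTd
  have hT : IsSelfAdjoint T := hP.add (isSelfAdjoint_smul_rankOne_self _ φ)
  have hTu : T u = u := by simp [hTd, hPu, hφu]
  have huφ : ⟪u, φ⟫_ℂ = 0 := inner_eq_zero_symm.1 hφu
  have hTφu : ⟪T φ, u⟫_ℂ = 0 := by
    have : ⟪T φ, u⟫_ℂ = ⟪φ, T u⟫_ℂ := hT.isSymmetric φ u
    rw [this, hTu, hφu]
  have huTφ : ⟪u, T φ⟫_ℂ = 0 := inner_eq_zero_symm.1 hTφu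
  set a : ℝ := (⟪T φ, φ⟫_ℂ).re with ha
  have haP : a = ‖P φ‖ ^ 2 - t := by
    rw [ha, hTd, re_inner_add_smul_rankOne, re_inner_projection_apply_self hP hP2]
    simp [inner_self_eq_norm_sq_to_K, hφ]
  set s : ℝ := √2⁻¹ with hs
  have hs2 : s ^ 2 = 2⁻¹ := Real.sq_sqrt (by norm_num)
  set ψ : H := (s : ℂ) • (u + φ) with hψd
  have hnorm_add : ‖u + φ‖ ^ 2 = 2 := by
    rw [@norm_add_sq ℂ, huφ, hu, hφ]; norm_num
  have hψ : ‖ψ‖ = 1 := by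
    have : ‖ψ‖ ^ 2 = 1 := by
      rw [hψd, norm_smul, mul_pow, hnorm_add, Complex.norm_real, Real.norm_eq_abs, sq_abs, hs2]
      norm_num
    exact (pow_eq_one_iff_of_nonneg (norm_nonneg _) two_ne_zero).1 this
  have hTψ : T ψ = (s : ℂ) • (u + T φ) := by rw [hψd, map_smul, map_add, hTu]
  have h1 : ‖T ψ‖ ^ 2 = (1 + ‖T φ‖ ^ 2) / 2 := by
    rw [hTψ, norm_smul, mul_pow, Complex.norm_real, Real.norm_eq_abs, sq_abs, hs2,
      @norm_add_sq ℂ, huTφ, hu]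
    simp
    ring
  have h2 : (⟪T ψ, ψ⟫_ℂ).re = (1 + a) / 2 := by
    have : ⟪T ψ, ψ⟫_ℂ = ((s ^ 2 : ℝ) : ℂ) * (1 + ⟪T φ, φ⟫_ℂ) := by
      rw [hTψ, hψd, inner_smul_left, inner_smul_right, inner_add_left, inner_add_right,
        inner_add_right, huφ, hTφu, inner_self_eq_norm_sq_to_K, hu]
      simp
      ring
    rw [this, Complex.re_ofReal_mul, hs2]
    simp [← ha]
    ring
  have h3 : |a| ≤ ‖T φ‖ := by
    have := norm_inner_le_norm (𝕜 := ℂ) (T φ) φ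
    rw [hφ, mul_one] at this
    exact (Complex.abs_re_le_norm _).trans this
  have h4 : a ^ 2 ≤ ‖T φ‖ ^ 2 := sq_le_sq.2 (by rwa [abs_norm])
  refine le_trans ?_ (sqrt_observableVar_le_maxDev hT hψ)
  rw [← haP]
  refine Real.le_sqrt_of_sq_le ?_
  rw [observableVar_eq_norm_sq_sub hT, h1, h2]
  nlinarith

theorem projection_eq_of_maxDev_add_finite_rank
    (P Q : H →L[ℂ] H) (hP : IsSelfAdjoint P) (hP2 : IsIdempotentElem P)
    (hQ : IsSelfAdjoint Q) (hQ2 : IsIdempotentElem Q)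
    (hP0 : P ≠ 0) (hP1 : P ≠ 1) (hQ0 : Q ≠ 0) (hQ1 : Q ≠ 1)
    (h : ∀ A : H →L[ℂ] H, IsSelfAdjoint A →
      FiniteDimensional ℂ (LinearMap.range (A : H →ₗ[ℂ] H)) →
      maxDev (P + A) = maxDev (Q + A)) :
    P = Q := by
  have hrange (φ : H) (t : ℝ) : FiniteDimensional ℂ
      (LinearMap.range ((((t : ℂ) • rankOne ℂ φ φ : H →L[ℂ] H)) : H →ₗ[ℂ] H)) := by
    refine Submodule.finiteDimensional_of_le (S₂ := ℂ ∙ φ) ?_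
    rintro _ ⟨x, rfl⟩
    exact Submodule.mem_span_singleton.2 ⟨t * ⟪φ, x⟫_ℂ, by simp [mul_smul]⟩
  have hneg (R : H →L[ℂ] H) (hR : FiniteDimensional ℂ (LinearMap.range (R : H →ₗ[ℂ] H))) :
      FiniteDimensional ℂ (LinearMap.range ((-R : H →L[ℂ] H) : H →ₗ[ℂ] H)) := by
    rwa [toLinearMap_neg, LinearMap.range_neg]
  by_cases hPfin : FiniteDimensional ℂ (LinearMap.range (P : H →ₗ[ℂ] H))
  · exact eq_of_maxDev_add_neg_eq hP hP2 hQ hQ2 hP0 hP1 (h _ hP.neg (hneg P hPfin))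
  by_cases hQfin : FiniteDimensional ℂ (LinearMap.range (Q : H →ₗ[ℂ] H))
  · exact (eq_of_maxDev_add_neg_eq hQ hQ2 hP hP2 hQ0 hQ1 (h _ hQ.neg (hneg Q hQfin)).symm).symm
  have hunit (φ : H) (hφ : ‖φ‖ = 1) : ‖P φ‖ ^ 2 = ‖Q φ‖ ^ 2 := by
    refine le_antisymm (le_of_forall_pos_le_add fun δ hδ => ?_)
      (le_of_forall_pos_le_add fun δ hδ => ?_) <;>
    have hA := h _ (isSelfAdjoint_smul_rankOne_self (-(1 + δ⁻¹)) φ) (hrange φ _)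
    · have h1 := le_maxDev_add_smul_rankOne hQ hQ2 hQfin hφ (1 + δ⁻¹)
      have h2 := maxDev_add_smul_rankOne_le hP hP2 hφ hδ
      linarith
    · have h1 := le_maxDev_add_smul_rankOne hP hP2 hPfin hφ (1 + δ⁻¹)
      have h2 := maxDev_add_smul_rankOne_le hQ hQ2 hφ hδ
      linarith
  have hall (x : H) : ‖P x‖ ^ 2 = ‖Q x‖ ^ 2 := by
    rcases eq_or_ne x 0 with rfl | hx
    · simp
    have := hunit (((‖x‖⁻¹ : ℝ) : ℂ) • x) (by simp [norm_smul, hx])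
    rw [map_smul, map_smul, norm_smul, norm_smul, mul_pow, mul_pow] at this
    exact mul_left_cancel₀ (by simp [hx]) this
  have hsymm := (hP.sub hQ).isSymmetric
  have hzero : ((P - Q : H →L[ℂ] H) : H →ₗ[ℂ] H) = 0 := by
    refine hsymm.inner_map_self_eq_zero.1 fun x => ?_
    have h1 := hsymm.coe_re_inner_apply_self x
    rw [← h1]
    have h2 : (⟪(P - Q) x, x⟫_ℂ).re = 0 := by
      rw [sub_apply, inner_sub_left, Complex.sub_re, re_inner_projection_apply_self hP hP2,
        re_inner_projection_apply_self hQ hQ2, hall, sub_self]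
    exact congrArg Complex.ofReal h2
  exact sub_eq_zero.1 (coe_injective hzero)
end

section
/- Let Q be a projection and R a rank-one projection on a complex Hilbert space H, and suppose 2 ∈ σ(Q + R). Then the range of R is contained in the range of Q, i.e., R ≤ Q. -/
/-- A rank-one perturbation formula of Sherman–Morrison type: if `b` inverts `a` and
`r * b * r = d • r` with `d ≠ 1`, then `a - r` is invertible. -/
theorem isUnit_sub_of_mul_mul_eq_smul {K A : Type*} [Field K] [Ring A] [Algebra K A]
    {a b r : A} {d : K} (hab : a * b = 1) (hba : b * a = 1) (hr : r * b * r = d • r)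
    (hd : d ≠ 1) : IsUnit (a - r) := by
  have hd' : 1 - d ≠ 0 := sub_ne_zero.mpr hd.symm
  have hk : (1 - d)⁻¹ - (1 - d)⁻¹ * d = 1 := by field_simp
  refine isUnit_iff_exists.mpr ⟨b + (1 - d)⁻¹ • (b * r * b), ?_, ?_⟩
  · have h1 : a * (b * r * b) = r * b := by rw [← mul_assoc, ← mul_assoc, hab, one_mul]
    have h2 : r * (b * r * b) = d • (r * b) := by
      rw [← mul_assoc, ← mul_assoc, hr, smul_mul_assoc]
    rw [sub_mul, mul_add, mul_add, mul_smul_comm, mul_smul_comm, h1, h2, hab, smul_smul]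
    linear_combination (norm := module) hk • (r * b)
  · have h1 : b * r * b * a = b * r := by rw [mul_assoc, hba, mul_one]
    have h2 : b * r * b * r = d • (b * r) := by
      rw [mul_assoc b r b, mul_assoc, hr, mul_smul_comm]
    rw [mul_sub, add_mul, add_mul, smul_mul_assoc, smul_mul_assoc, h1, h2, hba, smul_smul]
    linear_combination (norm := module) hk • (b * r)

/-- Compressing a linear map by an operator of rank one gives a multiple of that operator. -/
theorem ContinuousLinearMap.exists_mul_mul_eq_smul_of_finrank_range_eq_one
    {K E : Type*} [NormedField K] [NormedAddCommGroup E] [NormedSpace K E] {R : E →L[K] E}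
    (hrank : Module.finrank K (LinearMap.range (R : E →ₗ[K] E)) = 1) (T : E →L[K] E) :
    ∃ c : K, R * T * R = c • R := by
  obtain ⟨⟨v, hv⟩, -, hspan⟩ := finrank_eq_one_iff'.mp hrank
  have key (x : E) : ∃ a : K, a • v = R x := by
    obtain ⟨a, ha⟩ := hspan ⟨R x, x, rfl⟩
    exact ⟨a, congrArg Subtype.val ha⟩
  obtain ⟨c, hc⟩ := key (T v)
  refine ⟨c, ContinuousLinearMap.ext fun x => ?_⟩
  obtain ⟨a, ha⟩ := key x
  change R (T (R x)) = c • R x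
  rw [← ha, map_smul, map_smul, ← hc, smul_comm]

variable {H : Type*} [NormedAddCommGroup H] [InnerProductSpace ℂ H] [CompleteSpace H]

theorem rank_one_le_of_two_mem_spectrum
    (Q R : H →L[ℂ] H) (hQ : IsSelfAdjoint Q) (hQ2 : IsIdempotentElem Q)
    (hR : IsSelfAdjoint R) (hR2 : IsIdempotentElem R)
    (hRrank : Module.finrank ℂ (LinearMap.range (R : H →ₗ[ℂ] H)) = 1)
    (h : (2 : ℂ) ∈ spectrum ℂ (Q + R)) :
    Q * R = R := by
  obtain ⟨c, hc⟩ := ContinuousLinearMap.exists_mul_mul_eq_smul_of_finrank_range_eq_one hRrank Q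
  have hQQ : Q * Q = Q := hQ2
  have hRR : R * R = R := hR2
  have hc1 : c = 1 := by
    by_contra hne
    rw [spectrum.mem_iff] at h
    refine h ?_
    have hsub : algebraMap ℂ (H →L[ℂ] H) 2 - (Q + R) = (2 - Q) - R := by
      rw [map_ofNat, sub_add_eq_sub_sub]
    rw [hsub]
    have hprod : (2 - Q) * (1 + Q) = (2 : ℂ) • (1 : H →L[ℂ] H) := by
      rw [sub_mul, mul_add, mul_add, hQQ, two_smul, mul_one, mul_one, two_mul,
        ← one_add_one_eq_two]
      abel
    have hprod' : (1 + Q) * (2 - Q) = (2 : ℂ) • (1 : H →L[ℂ] H) := by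
      rw [mul_sub, add_mul, add_mul, hQQ, two_smul, one_mul, one_mul, mul_two,
        ← one_add_one_eq_two]
      abel
    refine isUnit_sub_of_mul_mul_eq_smul (K := ℂ) (b := (2⁻¹ : ℂ) • (1 + Q))
      (d := 2⁻¹ * (1 + c)) ?_ ?_ ?_ ?_
    · rw [mul_smul_comm, hprod, smul_smul, inv_mul_cancel₀ two_ne_zero, one_smul]
    · rw [smul_mul_assoc, hprod', smul_smul, inv_mul_cancel₀ two_ne_zero, one_smul]
    · rw [mul_smul_comm, smul_mul_assoc, mul_add, add_mul, mul_one, hRR, hc, mul_smul,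
        add_smul, one_smul]
    · intro hd
      exact hne (by linear_combination 2 * hd)
  rw [hc1, one_smul] at hc
  have hzero : star (R - Q * R) * (R - Q * R) = 0 := by
    rw [star_sub, star_mul, hQ.star_eq, hR.star_eq, sub_mul, mul_sub, mul_sub, hRR,
      ← mul_assoc, hc, mul_assoc R Q (Q * R), ← mul_assoc Q Q R, hQQ, ← mul_assoc, hc]
    simp
  exact (sub_eq_zero.mp (CStarRing.star_mul_self_eq_zero_iff _ |>.mp hzero)).symm
end

section
/- Let φ: B_s(H) → B_s(H) be a bijective linear map on the bounded self-adjoint operators of a complex Hilbert space H that preserves the operator norm: ‖φ(A)‖ = ‖A‖ for all A. Then there exists a unitary or antiunitary operator U on H such that either φ(A) = U A U* for all A, or φ(A) = −U A U* for all A. -/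
variable {H : Type*} [NormedAddCommGroup H] [InnerProductSpace ℂ H] [CompleteSpace H]

lemma AddMonoidHom.eq_or_eq_neg_of_forall {G K : Type*} [AddCommGroup G] [AddCommGroup K]
    (f g : G →+ K) (h : ∀ x, f x = g x ∨ f x = -g x) : f = g ∨ f = -g := by
  by_contra! hne
  obtain ⟨x, hx⟩ := DFunLike.ne_iff.mp hne.1
  obtain ⟨y, hy⟩ := DFunLike.ne_iff.mp hne.2
  have hx' := (h x).resolve_left hx
  have hy' := (h y).resolve_right hy
  rcases h (x + y) with hxy | hxy
  · apply hx
    simpa [hy'] using hxy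
  · apply hy
    rw [map_add, map_add, hx', neg_add] at hxy
    simpa using hxy

namespace selfAdjoint

open Complex InnerProductSpace ComplexConjugate

variable {A B : selfAdjoint (H →L[ℂ] H)} {x y u v w e f : H}

/-- The quadratic form `x ↦ ⟪A x, x⟫` of a bounded self-adjoint operator. -/
noncomputable def quadForm (A : selfAdjoint (H →L[ℂ] H)) (x : H) : ℝ :=
  (inner ℂ ((A : H →L[ℂ] H) x) x).re

lemma inner_apply_symm (A : selfAdjoint (H →L[ℂ] H)) (x y : H) :
    inner ℂ ((A : H →L[ℂ] H) x) y = inner ℂ x ((A : H →L[ℂ] H) y) :=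
  A.2.isSymmetric x y

lemma ofReal_quadForm (A : selfAdjoint (H →L[ℂ] H)) (x : H) :
    (quadForm A x : ℂ) = inner ℂ ((A : H →L[ℂ] H) x) x :=
  A.2.isSymmetric.coe_re_inner_apply_self x

lemma quadForm_ext (h : ∀ x, quadForm A x = quadForm B x) : A = B := by
  ext1
  have : ((A : H →L[ℂ] H) : H →ₗ[ℂ] H) = (B : H →L[ℂ] H) :=
    (ext_inner_map _ _).mp fun x => by
      have := congrArg ((↑) : ℝ → ℂ) (h x)
      rwa [ofReal_quadForm, ofReal_quadForm] at this
  exact ContinuousLinearMap.coe_injective this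

@[simp] lemma quadForm_add (A B : selfAdjoint (H →L[ℂ] H)) (x : H) :
    quadForm (A + B) x = quadForm A x + quadForm B x := by
  simp [quadForm]

@[simp] lemma quadForm_neg (A : selfAdjoint (H →L[ℂ] H)) (x : H) :
    quadForm (-A) x = -quadForm A x := by
  simp [quadForm]

@[simp] lemma quadForm_sub (A B : selfAdjoint (H →L[ℂ] H)) (x : H) :
    quadForm (A - B) x = quadForm A x - quadForm B x := by
  simp [sub_eq_add_neg]

@[simp] lemma quadForm_smul (r : ℝ) (A : selfAdjoint (H →L[ℂ] H)) (x : H) :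
    quadForm (r • A) x = r * quadForm A x := by
  rw [quadForm, selfAdjoint.val_smul, smul_apply, ← Complex.coe_smul,
    inner_smul_left, conj_ofReal, re_ofReal_mul, quadForm]

@[simp] lemma quadForm_zero (x : H) : quadForm 0 x = 0 := by
  simp [quadForm]

@[simp] lemma quadForm_one (x : H) : quadForm 1 x = ‖x‖ ^ 2 := by
  rw [quadForm, selfAdjoint.val_one, one_apply_eq_self]
  exact (norm_sq_eq_re_inner (𝕜 := ℂ) x).symm

lemma abs_quadForm_le (A : selfAdjoint (H →L[ℂ] H)) (x : H) :
    |quadForm A x| ≤ ‖(A : H →L[ℂ] H)‖ * ‖x‖ ^ 2 := by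
  calc |quadForm A x| ≤ ‖inner ℂ ((A : H →L[ℂ] H) x) x‖ := abs_re_le_norm _
    _ ≤ ‖(A : H →L[ℂ] H) x‖ * ‖x‖ := norm_inner_le_norm _ _
    _ ≤ ‖(A : H →L[ℂ] H)‖ * ‖x‖ * ‖x‖ := by gcongr; exact ContinuousLinearMap.le_opNorm _ _
    _ = _ := by ring

lemma norm_le_of_abs_quadForm_le {M : ℝ} (hM : 0 ≤ M)
    (h : ∀ x, |quadForm A x| ≤ M * ‖x‖ ^ 2) : ‖(A : H →L[ℂ] H)‖ ≤ M := by
  rw [ContinuousLinearMap.norm_eq_iSup_rayleighQuotient _ A.2.isSymmetric]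
  refine ciSup_le fun x => ?_
  rw [ContinuousLinearMap.rayleighQuotient, abs_div, abs_of_nonneg (sq_nonneg ‖x‖)]
  exact div_le_of_le_mul₀ (sq_nonneg _) hM (h x)

lemma quadForm_nonneg_iff {M : ℝ} (hM : ‖(A : H →L[ℂ] H)‖ ≤ M) :
    (∀ x, 0 ≤ quadForm A x) ↔
      ‖((M • 1 - A : selfAdjoint (H →L[ℂ] H)) : H →L[ℂ] H)‖ ≤ M := by
  have hM0 : 0 ≤ M := (norm_nonneg _).trans hM
  constructor
  · refine fun h => norm_le_of_abs_quadForm_le hM0 fun x => ?_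
    have h1 := abs_quadForm_le A x
    have h2 : ‖(A : H →L[ℂ] H)‖ * ‖x‖ ^ 2 ≤ M * ‖x‖ ^ 2 := by gcongr
    have h3 := h x
    rw [abs_le] at h1 ⊢
    simp only [quadForm_sub, quadForm_smul, quadForm_one]
    constructor <;> linarith
  · intro h x
    have h1 := (abs_quadForm_le (M • 1 - A) x).trans
      (mul_le_mul_of_nonneg_right h (sq_nonneg ‖x‖))
    rw [abs_le] at h1
    simp only [quadForm_sub, quadForm_smul, quadForm_one] at h1
    linarith

/-- The Cauchy-Schwarz inequality for a positive operator. -/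
lemma norm_inner_apply_sq_le (h : ∀ x, 0 ≤ quadForm A x) (x y : H) :
    ‖inner ℂ ((A : H →L[ℂ] H) x) y‖ ^ 2 ≤ quadForm A x * quadForm A y := by
  let c : PreInnerProductSpace.Core ℂ H :=
    { inner := fun x y => inner ℂ ((A : H →L[ℂ] H) x) y
      conj_inner_symm := fun x y => by
        rw [inner_conj_symm, inner_apply_symm]
      re_inner_nonneg := h
      add_left := fun x y z => by simp
      smul_left := fun x y r => by simp [mul_comm] }
  have := @InnerProductSpace.Core.inner_mul_inner_self_le ℂ H _ _ _ c x y
  have h2 : ‖inner ℂ ((A : H →L[ℂ] H) x) y‖ * ‖inner ℂ ((A : H →L[ℂ] H) y) x‖ ≤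
    quadForm A x * quadForm A y := this
  rwa [inner_apply_symm A y x, norm_inner_symm y, ← sq] at h2

/-- The rank one positive operator `y ↦ ⟪x, y⟫ • x`. -/
noncomputable def rankOneSelf (x : H) : selfAdjoint (H →L[ℂ] H) :=
  ⟨rankOne ℂ x x, (isPositive_rankOne_self x).isSelfAdjoint⟩

@[simp] lemma rankOneSelf_apply (x y : H) :
    (rankOneSelf x : H →L[ℂ] H) y = inner ℂ x y • x := rfl

lemma norm_rankOneSelf (x : H) : ‖(rankOneSelf x : H →L[ℂ] H)‖ = ‖x‖ ^ 2 := by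
  rw [sq]; exact norm_rankOne x x

@[simp] lemma quadForm_rankOneSelf (x y : H) :
    quadForm (rankOneSelf x) y = ‖inner ℂ x y‖ ^ 2 := by
  rw [quadForm, rankOneSelf_apply, inner_smul_left, mul_comm, mul_conj, ofReal_re, normSq_eq_norm_sq]

lemma rankOneSelf_zero : rankOneSelf (0 : H) = 0 :=
  quadForm_ext fun y => by simp

lemma rankOneSelf_smul (c : ℂ) (x : H) : rankOneSelf (c • x) = ‖c‖ ^ 2 • rankOneSelf x :=
  quadForm_ext fun y => by simp [mul_pow, mul_comm]

lemma rankOneSelf_add_add_sub (x y : H) :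
    rankOneSelf (x + y) + rankOneSelf (x - y) = (2 : ℝ) • rankOneSelf x + (2 : ℝ) • rankOneSelf y :=
  quadForm_ext fun z => by
    simp only [quadForm_add, quadForm_smul, quadForm_rankOneSelf, inner_add_left, inner_sub_left]
    have := parallelogram_law_with_norm ℝ (inner ℂ x z) (inner ℂ y z)
    linarith

lemma exists_smul_of_rankOneSelf_eq (h : rankOneSelf x = rankOneSelf y) : ∃ c : ℂ, x = c • y := by
  rcases eq_or_ne x 0 with rfl | hx
  · exact ⟨0, by simp⟩
  · have := congrArg (fun A : selfAdjoint (H →L[ℂ] H) => (A : H →L[ℂ] H) x) h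
    simp only [rankOneSelf_apply] at this
    refine ⟨(inner ℂ x x)⁻¹ * inner ℂ y x, ?_⟩
    rw [mul_smul, ← this, smul_smul, inv_mul_cancel₀ (inner_self_ne_zero.mpr hx), one_smul]

/-- First-order expansion of the norm along a rank one projection. -/
lemma norm_smul_rankOneSelf_add_le {K t : ℝ} (hx : ‖x‖ = 1) (hK : 0 < K)
    (hA : ‖(A : H →L[ℂ] H)‖ ≤ K) (ht : 4 * K ≤ t) :
    ‖((t • rankOneSelf x + A : selfAdjoint (H →L[ℂ] H)) : H →L[ℂ] H)‖ ≤
      t + quadForm A x + 2 * K ^ 2 / t := by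
  have ht0 : 0 < t := by linarith
  have hq (y : H) : |quadForm A y| ≤ K * ‖y‖ ^ 2 :=
    (abs_quadForm_le A y).trans (by gcongr)
  have ha := hq x
  rw [hx, one_pow, mul_one, abs_le] at ha
  have hp : 0 < 2 * K ^ 2 / t := by positivity
  refine norm_le_of_abs_quadForm_le (by linarith) fun y => ?_
  set c := inner ℂ x y with hc
  set z := y - c • x with hz
  have hyz : y = c • x + z := by simp [hz]
  have hxz : inner ℂ x z = 0 := by
    simp [hz, inner_self_eq_norm_sq_to_K, hx, hc]
  have hnorm : ‖y‖ ^ 2 = ‖c‖ ^ 2 + ‖z‖ ^ 2 := by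
    have := norm_add_sq_eq_norm_sq_add_norm_sq_of_inner_eq_zero (𝕜 := ℂ) (c • x) z
      (by simp [inner_smul_left, hxz])
    rw [← hyz, norm_smul, hx, mul_one] at this
    linarith
  have hquad : quadForm A y = ‖c‖ ^ 2 * quadForm A x +
      2 * (inner ℂ ((A : H →L[ℂ] H) (c • x)) z).re + quadForm A z := by
    have h1 : (inner ℂ ((A : H →L[ℂ] H) z) (c • x)).re =
        (inner ℂ ((A : H →L[ℂ] H) (c • x)) z).re := by
      rw [inner_apply_symm, ← inner_conj_symm, conj_re]
    have h2 : (inner ℂ ((A : H →L[ℂ] H) (c • x)) (c • x)).re = ‖c‖ ^ 2 * quadForm A x := by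
      rw [map_smul, inner_smul_left, inner_smul_right, ← mul_assoc, mul_comm (conj c), mul_conj,
        re_ofReal_mul, normSq_eq_norm_sq, quadForm]
    rw [hyz, quadForm, map_add, inner_add_left, inner_add_right, inner_add_right]
    simp only [add_re]
    rw [h1, h2, quadForm, quadForm]
    ring
  have hm : |(inner ℂ ((A : H →L[ℂ] H) (c • x)) z).re| ≤ K * ‖c‖ * ‖z‖ := by
    calc _ ≤ ‖inner ℂ ((A : H →L[ℂ] H) (c • x)) z‖ := abs_re_le_norm _
      _ ≤ ‖(A : H →L[ℂ] H) (c • x)‖ * ‖z‖ := norm_inner_le_norm _ _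
      _ ≤ (K * ‖c • x‖) * ‖z‖ := by
        gcongr; exact (ContinuousLinearMap.le_opNorm _ _).trans (by gcongr)
      _ = _ := by rw [norm_smul, hx, mul_one]
  have hy := hq y
  have hz' := hq z
  rw [abs_le] at hy hz' hm ⊢
  simp only [quadForm_add, quadForm_smul, quadForm_rankOneSelf, ← hc]
  constructor
  · nlinarith [mul_nonneg ht0.le (sq_nonneg ‖c‖), mul_nonneg hp.le (sq_nonneg ‖y‖),
      mul_nonneg (by linarith : 0 ≤ t + quadForm A x - K) (sq_nonneg ‖y‖)]
  · rw [hquad, hnorm]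
    have h1 : 2 * (K * ‖c‖ * ‖z‖) ≤ 2 * K ^ 2 / t * ‖c‖ ^ 2 + t / 2 * ‖z‖ ^ 2 := by
      have h2 : 2 * K ^ 2 / t * ‖c‖ ^ 2 + t / 2 * ‖z‖ ^ 2 - 2 * (K * ‖c‖ * ‖z‖) =
          (2 * K * ‖c‖ - t * ‖z‖) ^ 2 / (2 * t) := by field_simp; ring
      have h3 : 0 ≤ (2 * K * ‖c‖ - t * ‖z‖) ^ 2 / (2 * t) := by positivity
      linarith
    nlinarith [mul_nonneg hp.le (sq_nonneg ‖z‖),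
      mul_nonneg (by linarith : 0 ≤ t / 2 + quadForm A x - K) (sq_nonneg ‖z‖)]

/-- A nonzero positive operator spanning an extreme ray of the cone of positive operators. -/
def IsExtremal (A : selfAdjoint (H →L[ℂ] H)) : Prop :=
  (∀ x, 0 ≤ quadForm A x) ∧ A ≠ 0 ∧
    ∀ B : selfAdjoint (H →L[ℂ] H), (∀ x, 0 ≤ quadForm B x) →
      (∀ x, quadForm B x ≤ quadForm A x) → ∃ t : ℝ, B = t • A

lemma isExtremal_rankOneSelf (hu : u ≠ 0) : IsExtremal (rankOneSelf u) := by
  have hu' : inner ℂ u u ≠ 0 := inner_self_ne_zero.mpr hu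
  refine ⟨fun x => by simp, fun h => ?_, fun B hB hBu => ?_⟩
  · have := norm_rankOneSelf u
    rw [h, ZeroMemClass.coe_zero, norm_zero, eq_comm, sq_eq_zero_iff, norm_eq_zero] at this
    exact hu this
  · have hperp (y : H) (hy : inner ℂ u y = 0) : (B : H →L[ℂ] H) y = 0 := by
      have h1 : quadForm B y = 0 := le_antisymm (by simpa [hy] using hBu y) (hB y)
      have h2 := norm_inner_apply_sq_le hB y ((B : H →L[ℂ] H) y)
      rw [h1, zero_mul] at h2
      exact inner_self_eq_zero.mp (norm_eq_zero.mp (pow_eq_zero_iff two_ne_zero |>.mp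
        (le_antisymm h2 (sq_nonneg _))))
    refine ⟨quadForm B u / ‖inner ℂ u u‖ ^ 2, quadForm_ext fun y => ?_⟩
    set c := (inner ℂ u u)⁻¹ * inner ℂ u y with hc
    have hz := hperp (y - c • u) (by
      rw [inner_sub_right, inner_smul_right, hc]
      field_simp
      ring)
    have hBy : (B : H →L[ℂ] H) y = c • (B : H →L[ℂ] H) u := by
      rwa [map_sub, map_smul, sub_eq_zero] at hz
    have : quadForm B y = ‖c‖ ^ 2 * quadForm B u := by
      have h3 : inner ℂ ((B : H →L[ℂ] H) u) y = c * inner ℂ ((B : H →L[ℂ] H) u) u := by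
        rw [inner_apply_symm, hBy, inner_smul_right, inner_apply_symm]
      rw [quadForm, hBy, inner_smul_left, h3, ← mul_assoc, mul_comm (conj c), mul_conj,
        re_ofReal_mul, normSq_eq_norm_sq, quadForm]
    rw [this, quadForm_smul, quadForm_rankOneSelf, hc, norm_mul, norm_inv]
    ring

lemma IsExtremal.exists_eq_rankOneSelf (hA : IsExtremal A) : ∃ w, A = rankOneSelf w := by
  obtain ⟨hpos, hne, hext⟩ := hA
  obtain ⟨x, hx⟩ : ∃ x, quadForm A x ≠ 0 := by
    by_contra! h
    exact hne (quadForm_ext fun x => by simp [h])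
  have ha : 0 < quadForm A x := lt_of_le_of_ne (hpos x) hx.symm
  set v := (A : H →L[ℂ] H) x with hv
  obtain ⟨t, ht⟩ := hext ((quadForm A x)⁻¹ • rankOneSelf v)
    (fun y => by simp only [quadForm_smul, quadForm_rankOneSelf]; positivity)
    (fun y => by
      rw [quadForm_smul, quadForm_rankOneSelf, inv_mul_le_iff₀ ha]
      exact norm_inner_apply_sq_le hpos x y)
  have ht1 : t = 1 := by
    have := congrArg (fun B => quadForm B x) ht
    simp only [quadForm_smul, quadForm_rankOneSelf, hv, ← ofReal_quadForm, norm_real,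
      Real.norm_eq_abs, sq_abs] at this
    field_simp at this
    exact this.symm
  refine ⟨((Real.sqrt (quadForm A x)⁻¹ : ℝ) : ℂ) • v, ?_⟩
  rw [rankOneSelf_smul, norm_real, Real.norm_eq_abs, sq_abs, Real.sq_sqrt (by positivity), ht, ht1,
    one_smul ℝ A]

lemma le_of_forall_le_add_div {a b C T : ℝ} (h : ∀ t, T ≤ t → a ≤ b + C / t) : a ≤ b := by
  have hlim : Filter.Tendsto (fun t : ℝ => b + C / t) Filter.atTop (nhds (b + 0)) :=
    tendsto_const_nhds.add (tendsto_const_nhds.div_atTop Filter.tendsto_id)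
  rw [add_zero] at hlim
  exact ge_of_tendsto hlim (Filter.eventually_atTop.mpr ⟨T, h⟩)

lemma one_add_norm_le_max [Nontrivial H] (A : selfAdjoint (H →L[ℂ] H)) :
    1 + ‖(A : H →L[ℂ] H)‖ ≤ max ‖((A + 1 : selfAdjoint (H →L[ℂ] H)) : H →L[ℂ] H)‖
      ‖((A - 1 : selfAdjoint (H →L[ℂ] H)) : H →L[ℂ] H)‖ := by
  set m := max ‖((A + 1 : selfAdjoint (H →L[ℂ] H)) : H →L[ℂ] H)‖
      ‖((A - 1 : selfAdjoint (H →L[ℂ] H)) : H →L[ℂ] H)‖ with hm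
  have hbound (x : H) : |quadForm A x| ≤ (m - 1) * ‖x‖ ^ 2 := by
    have h1 := (abs_quadForm_le (A + 1) x).trans
      (mul_le_mul_of_nonneg_right (le_max_left _ _ : _ ≤ m) (sq_nonneg ‖x‖))
    have h2 := (abs_quadForm_le (A - 1) x).trans
      (mul_le_mul_of_nonneg_right (le_max_right _ _ : _ ≤ m) (sq_nonneg ‖x‖))
    rw [abs_le] at h1 h2 ⊢
    simp only [quadForm_add, quadForm_sub, quadForm_one] at h1 h2
    constructor <;> linarith
  have hm1 : 0 ≤ m - 1 := by
    obtain ⟨x, hx⟩ := exists_ne (0 : H)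
    have h := (abs_nonneg _).trans (hbound x)
    exact nonneg_of_mul_nonneg_left h (by positivity)
  linarith [norm_le_of_abs_quadForm_le hm1 hbound]

lemma apply_eq_or_eq_neg_of_quadForm {x : H} (hx : ‖x‖ = 1) (hA : ‖(A : H →L[ℂ] H)‖ ≤ 1)
    (h : 1 ≤ |quadForm A x|) : (A : H →L[ℂ] H) x = x ∨ (A : H →L[ℂ] H) x = -x := by
  have hAx : ‖(A : H →L[ℂ] H) x‖ ≤ 1 := by
    simpa [hx] using ContinuousLinearMap.le_of_opNorm_le _ hA x
  have hre : RCLike.re (inner ℂ ((A : H →L[ℂ] H) x) x) = quadForm A x := rfl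
  rcases le_abs.mp h with h | h
  · left
    have := norm_sub_sq (𝕜 := ℂ) ((A : H →L[ℂ] H) x) x
    rw [hre, hx] at this
    rw [← sub_eq_zero, ← norm_eq_zero, ← sq_eq_zero_iff]
    nlinarith [norm_nonneg ((A : H →L[ℂ] H) x), sq_nonneg ‖(A : H →L[ℂ] H) x - x‖]
  · right
    have := norm_add_sq (𝕜 := ℂ) ((A : H →L[ℂ] H) x) x
    rw [hre, hx] at this
    rw [← add_eq_zero_iff_eq_neg, ← norm_eq_zero, ← sq_eq_zero_iff]
    nlinarith [norm_nonneg ((A : H →L[ℂ] H) x), sq_nonneg ‖(A : H →L[ℂ] H) x + x‖]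

variable {φ : selfAdjoint (H →L[ℂ] H) ≃ₗ[ℝ] selfAdjoint (H →L[ℂ] H)}

lemma equiv_map_neg (φ : selfAdjoint (H →L[ℂ] H) ≃ₗ[ℝ] selfAdjoint (H →L[ℂ] H))
    (A : selfAdjoint (H →L[ℂ] H)) : φ (-A) = -φ A :=
  φ.toAddEquiv.toAddMonoidHom.map_neg A

lemma equiv_map_sub (φ : selfAdjoint (H →L[ℂ] H) ≃ₗ[ℝ] selfAdjoint (H →L[ℂ] H))
    (A B : selfAdjoint (H →L[ℂ] H)) : φ (A - B) = φ A - φ B :=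
  φ.toAddEquiv.toAddMonoidHom.map_sub A B

lemma norm_symm_apply
    (hφ : ∀ A : selfAdjoint (H →L[ℂ] H), ‖(φ A : H →L[ℂ] H)‖ = ‖(A : H →L[ℂ] H)‖)
    (A : selfAdjoint (H →L[ℂ] H)) : ‖(φ.symm A : H →L[ℂ] H)‖ = ‖(A : H →L[ℂ] H)‖ := by
  rw [← hφ, φ.apply_symm_apply]

lemma one_le_abs_quadForm_map_one [Nontrivial H]
    (hφ : ∀ A : selfAdjoint (H →L[ℂ] H), ‖(φ A : H →L[ℂ] H)‖ = ‖(A : H →L[ℂ] H)‖)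
    {x : H} (hx : ‖x‖ = 1) : 1 ≤ |quadForm (φ 1) x| := by
  have hφ1 : ‖(φ 1 : H →L[ℂ] H)‖ ≤ 1 := by
    rw [hφ, selfAdjoint.val_one, norm_one]
  refine le_of_forall_le_add_div (T := 4) (C := 2) fun t ht => ?_
  have ht0 : 0 < t := by linarith
  set C := φ.symm (t • rankOneSelf x) with hC
  have hφC : φ C = t • rankOneSelf x := φ.apply_symm_apply _
  have hCn : ‖(C : H →L[ℂ] H)‖ = t := by
    rw [← hφ, hφC, selfAdjoint.val_smul, norm_smul, norm_rankOneSelf, hx, Real.norm_eq_abs,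
      abs_of_pos ht0, one_pow, mul_one]
  have h := one_add_norm_le_max C
  rw [hCn, ← hφ (C + 1), ← hφ (C - 1), φ.map_add, equiv_map_sub, hφC, le_max_iff] at h
  rcases h with h | h
  · have h' := norm_smul_rankOneSelf_add_le hx one_pos hφ1 (by linarith : 4 * 1 ≤ t)
    have := le_abs_self (quadForm (φ 1) x)
    rw [one_pow, mul_one] at h'
    linarith
  · rw [sub_eq_add_neg] at h
    have h' := norm_smul_rankOneSelf_add_le (A := -φ 1) hx one_pos
      (by rwa [NegMemClass.coe_neg, norm_neg]) (by linarith : 4 * 1 ≤ t)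
    have := neg_le_abs (quadForm (φ 1) x)
    rw [one_pow, mul_one, quadForm_neg] at h'
    linarith

lemma map_one_eq_one_or_neg_one [Nontrivial H]
    (hφ : ∀ A : selfAdjoint (H →L[ℂ] H), ‖(φ A : H →L[ℂ] H)‖ = ‖(A : H →L[ℂ] H)‖) :
    φ 1 = 1 ∨ φ 1 = -1 := by
  have hφ1 : ‖(φ 1 : H →L[ℂ] H)‖ ≤ 1 := by
    rw [hφ, selfAdjoint.val_one, norm_one]
  have key (x : H) : (φ 1 : H →L[ℂ] H) x = x ∨ (φ 1 : H →L[ℂ] H) x = -x := by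
    rcases eq_or_ne x 0 with rfl | hx
    · simp
    · have hx' : ((‖x‖ : ℝ) : ℂ) ≠ 0 := by simpa using hx
      have hu : ‖((‖x‖ : ℝ) : ℂ)⁻¹ • x‖ = 1 := by
        rw [norm_smul, norm_inv, norm_real, norm_norm, inv_mul_cancel₀ (norm_ne_zero_iff.mpr hx)]
      have := apply_eq_or_eq_neg_of_quadForm hu hφ1 (one_le_abs_quadForm_map_one hφ hu)
      simpa only [map_smul, ← smul_neg, smul_right_inj (inv_ne_zero hx')] using this
  refine (AddMonoidHom.eq_or_eq_neg_of_forall ((φ 1 : H →L[ℂ] H) : H →+ H)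
    (AddMonoidHom.id H) key).imp (fun h => ?_) (fun h => ?_)
  · ext x
    exact DFunLike.congr_fun h x
  · ext x
    exact DFunLike.congr_fun h x

lemma quadForm_map_nonneg
    (hφ : ∀ A : selfAdjoint (H →L[ℂ] H), ‖(φ A : H →L[ℂ] H)‖ = ‖(A : H →L[ℂ] H)‖)
    (h1 : φ 1 = 1) (h : ∀ x, 0 ≤ quadForm A x) (x : H) : 0 ≤ quadForm (φ A) x := by
  refine (quadForm_nonneg_iff (hφ A).le).mpr ?_ x
  rw [← h1, ← φ.map_smul, ← equiv_map_sub, hφ]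
  exact (quadForm_nonneg_iff le_rfl).mp h

lemma IsExtremal.map
    (hφ : ∀ A : selfAdjoint (H →L[ℂ] H), ‖(φ A : H →L[ℂ] H)‖ = ‖(A : H →L[ℂ] H)‖)
    (h1 : φ 1 = 1) (hA : IsExtremal A) : IsExtremal (φ A) := by
  have h1' : φ.symm 1 = 1 := by rw [← h1, φ.symm_apply_apply, h1]
  refine ⟨quadForm_map_nonneg hφ h1 hA.1, fun h => hA.2.1 (φ.map_eq_zero_iff.mp h),
    fun B hB hBA => ?_⟩
  obtain ⟨t, ht⟩ := hA.2.2 (φ.symm B) (quadForm_map_nonneg (norm_symm_apply hφ) h1' hB) fun x => by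
    have := quadForm_map_nonneg (A := φ A - B) (norm_symm_apply hφ) h1'
      (fun y => by rw [quadForm_sub]; exact sub_nonneg.mpr (hBA y)) x
    rwa [equiv_map_sub, φ.symm_apply_apply, quadForm_sub, sub_nonneg] at this
  exact ⟨t, by rw [← φ.map_smul, ← ht, φ.apply_symm_apply]⟩

lemma exists_map_rankOneSelf
    (hφ : ∀ A : selfAdjoint (H →L[ℂ] H), ‖(φ A : H →L[ℂ] H)‖ = ‖(A : H →L[ℂ] H)‖)
    (h1 : φ 1 = 1) (x : H) : ∃ w, φ (rankOneSelf x) = rankOneSelf w := by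
  rcases eq_or_ne x 0 with rfl | hx
  · exact ⟨0, by rw [rankOneSelf_zero, φ.map_zero]⟩
  · exact ((isExtremal_rankOneSelf hx).map hφ h1).exists_eq_rankOneSelf

lemma quadForm_map_le_of_norm_eq_one
    (hφ : ∀ A : selfAdjoint (H →L[ℂ] H), ‖(φ A : H →L[ℂ] H)‖ = ‖(A : H →L[ℂ] H)‖)
    (hxw : φ (rankOneSelf x) = rankOneSelf w) (hx : ‖x‖ = 1) (A : selfAdjoint (H →L[ℂ] H)) :
    quadForm (φ A) w ≤ quadForm A x := by
  have hw : ‖w‖ = 1 := by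
    have := norm_rankOneSelf w
    rw [← hxw, hφ, norm_rankOneSelf, hx, one_pow] at this
    exact (pow_eq_one_iff_of_nonneg (norm_nonneg w) two_ne_zero).mp this.symm
  set K := ‖(A : H →L[ℂ] H)‖ + 1 with hK
  have hK0 : 0 < K := by positivity
  refine le_of_forall_le_add_div (T := 4 * K) (C := 2 * K ^ 2) fun t ht => ?_
  have h := norm_smul_rankOneSelf_add_le hx hK0 (by linarith : ‖(A : H →L[ℂ] H)‖ ≤ K) ht
  rw [← hφ, φ.map_add, φ.map_smul, hxw] at h
  have h2 := (le_abs_self _).trans (abs_quadForm_le (t • rankOneSelf w + φ A) w)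
  rw [quadForm_add, quadForm_smul, quadForm_rankOneSelf, inner_self_eq_norm_sq_to_K, hw] at h2
  simp only [map_one, one_pow, norm_one, mul_one] at h2
  linarith

/-- The vector state of `x` is transported to the vector state of `w` when `φ` sends the rank one
operator of `x` to that of `w`. -/
lemma quadForm_map
    (hφ : ∀ A : selfAdjoint (H →L[ℂ] H), ‖(φ A : H →L[ℂ] H)‖ = ‖(A : H →L[ℂ] H)‖)
    (hxw : φ (rankOneSelf x) = rankOneSelf w) (A : selfAdjoint (H →L[ℂ] H)) :
    quadForm (φ A) w = quadForm A x := by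
  have hscale (B : selfAdjoint (H →L[ℂ] H)) (c : ℝ) (y : H) :
      quadForm B ((c : ℂ) • y) = c ^ 2 * quadForm B y := by
    rw [quadForm, map_smul, inner_smul_left, inner_smul_right, conj_ofReal, re_ofReal_mul,
      re_ofReal_mul, quadForm]
    ring
  rcases eq_or_ne x 0 with rfl | hx
  · have := norm_rankOneSelf w
    rw [← hxw, hφ, norm_rankOneSelf, norm_zero, zero_pow two_ne_zero, eq_comm, sq_eq_zero_iff,
      norm_eq_zero] at this
    simp [this, quadForm]
  · have hn : ‖x‖ ≠ 0 := norm_ne_zero_iff.mpr hx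
    set c : ℝ := ‖x‖⁻¹ with hc
    have hc0 : 0 < c ^ 2 := by positivity
    have hu : ‖(c : ℂ) • x‖ = 1 := by
      rw [norm_smul, norm_real, hc, norm_inv, norm_norm, inv_mul_cancel₀ hn]
    have hcw : φ (rankOneSelf ((c : ℂ) • x)) = rankOneSelf ((c : ℂ) • w) := by
      rw [rankOneSelf_smul, rankOneSelf_smul, φ.map_smul, hxw]
    have h1 := quadForm_map_le_of_norm_eq_one hφ hcw hu A
    have h2 := quadForm_map_le_of_norm_eq_one hφ hcw hu (-A)
    rw [hscale, hscale] at h1 h2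
    rw [equiv_map_neg, quadForm_neg, quadForm_neg] at h2
    have := le_of_mul_le_mul_left h1 hc0
    have := le_of_mul_le_mul_left (by linarith : c ^ 2 * quadForm A x ≤ c ^ 2 * quadForm (φ A) w) hc0
    linarith

/-- A linear bijection permuting the rank one positive operators compatibly with their vector
states. -/
structure PreservesRankOne (φ : selfAdjoint (H →L[ℂ] H) ≃ₗ[ℝ] selfAdjoint (H →L[ℂ] H)) :
    Prop where
  exists_map_eq (x : H) : ∃ w, φ (rankOneSelf x) = rankOneSelf w
  exists_eq_map (w : H) : ∃ x, φ (rankOneSelf x) = rankOneSelf w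
  quadForm_map {x w : H} (h : φ (rankOneSelf x) = rankOneSelf w)
    (A : selfAdjoint (H →L[ℂ] H)) : quadForm (φ A) w = quadForm A x

lemma PreservesRankOne.of_norm_map
    (hφ : ∀ A : selfAdjoint (H →L[ℂ] H), ‖(φ A : H →L[ℂ] H)‖ = ‖(A : H →L[ℂ] H)‖)
    (h1 : φ 1 = 1) : PreservesRankOne φ where
  exists_map_eq := exists_map_rankOneSelf hφ h1
  exists_eq_map w := by
    obtain ⟨x, hx⟩ := exists_map_rankOneSelf (norm_symm_apply hφ)
      (by rw [← h1, φ.symm_apply_apply, h1]) w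
    exact ⟨x, by rw [← hx, φ.apply_symm_apply]⟩
  quadForm_map h A := _root_.selfAdjoint.quadForm_map hφ h A

/-- The polarization of `rankOneSelf`, that is, `y ↦ ⟪e, y⟫ • x + ⟪x, y⟫ • e`. -/
noncomputable def polarRankOne (e x : H) : selfAdjoint (H →L[ℂ] H) :=
  rankOneSelf (e + x) - rankOneSelf e - rankOneSelf x

lemma quadForm_polarRankOne (e x y : H) :
    quadForm (polarRankOne e x) y = 2 * (inner ℂ e y * conj (inner ℂ x y)).re := by
  simp only [polarRankOne, quadForm_sub, quadForm_rankOneSelf, inner_add_left,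
    ← normSq_eq_norm_sq, normSq_add]
  ring

lemma polarRankOne_add (e x y : H) :
    polarRankOne e (x + y) = polarRankOne e x + polarRankOne e y :=
  quadForm_ext fun z => by
    simp only [quadForm_add, quadForm_polarRankOne, inner_add_left, map_add, mul_add, add_re]

lemma polarRankOne_smul (e : H) (r : ℝ) (x : H) :
    polarRankOne e (r • x) = r • polarRankOne e x :=
  quadForm_ext fun z => by
    rw [quadForm_smul, quadForm_polarRankOne, quadForm_polarRankOne, ← Complex.coe_smul,
      inner_smul_left, conj_ofReal, map_mul, conj_ofReal, mul_left_comm, re_ofReal_mul]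
    ring

/-- The real-linear map `x ↦ φ (polarRankOne e x) f`. -/
noncomputable def crossMap (φ : selfAdjoint (H →L[ℂ] H) ≃ₗ[ℝ] selfAdjoint (H →L[ℂ] H))
    (e f : H) : H →ₗ[ℝ] H where
  toFun x := (φ (polarRankOne e x) : H →L[ℂ] H) f
  map_add' x y := by
    rw [polarRankOne_add, φ.map_add, AddSubgroup.coe_add, add_apply]
  map_smul' r x := by
    rw [polarRankOne_smul, φ.map_smul, selfAdjoint.val_smul, smul_apply, RingHom.id_apply]

namespace PreservesRankOne

variable (hφ : PreservesRankOne φ)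
include hφ

lemma norm_inner_eq {x' y' : H} (hx : φ (rankOneSelf x) = rankOneSelf x')
    (hy : φ (rankOneSelf y) = rankOneSelf y') : ‖inner ℂ x' y'‖ = ‖inner ℂ x y‖ := by
  have := hφ.quadForm_map hy (rankOneSelf x)
  rw [hx, quadForm_rankOneSelf, quadForm_rankOneSelf] at this
  exact (sq_eq_sq₀ (norm_nonneg _) (norm_nonneg _)).mp this

lemma norm_eq (hx : φ (rankOneSelf x) = rankOneSelf w) : ‖w‖ = ‖x‖ := by
  have := hφ.norm_inner_eq hx hx
  rw [inner_self_eq_norm_sq_to_K, inner_self_eq_norm_sq_to_K] at this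
  simpa using this

section

variable (he : ‖e‖ = 1) (hef : φ (rankOneSelf e) = rankOneSelf f)
include he hef

lemma map_rankOneSelf_add_and_inner_crossMap (hx : inner ℂ e x = 0) :
    φ (rankOneSelf (e + x)) = rankOneSelf (f + crossMap φ e f x) ∧
      inner ℂ f (crossMap φ e f x) = 0 := by
  have hf : ‖f‖ = 1 := (hφ.norm_eq hef).trans he
  have hff : inner ℂ f f = 1 := by simp [inner_self_eq_norm_sq_to_K, hf]
  have hee : inner ℂ e e = 1 := by simp [inner_self_eq_norm_sq_to_K, he]
  obtain ⟨w, hw⟩ := hφ.exists_map_eq (e + x)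
  obtain ⟨z, hz⟩ := hφ.exists_map_eq x
  have hzf : inner ℂ z f = 0 := by
    rw [← norm_eq_zero, hφ.norm_inner_eq hz hef, norm_eq_zero]
    exact inner_eq_zero_symm.mp hx
  have hwf : ‖inner ℂ w f‖ = 1 := by
    rw [hφ.norm_inner_eq hw hef, inner_add_left, hee, inner_eq_zero_symm.mp hx, add_zero, norm_one]
  have hsum : f + crossMap φ e f x = inner ℂ w f • w := by
    have h1 : rankOneSelf (e + x) = rankOneSelf e + polarRankOne e x + rankOneSelf x := by
      rw [polarRankOne]; abel
    have h2 : (φ (rankOneSelf (e + x)) : H →L[ℂ] H) f = f + crossMap φ e f x := by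
      rw [h1, φ.map_add, φ.map_add, hef, hz, AddSubgroup.coe_add, AddSubgroup.coe_add,
        add_apply, add_apply, rankOneSelf_apply, rankOneSelf_apply, hzf, hff, zero_smul, one_smul,
        add_zero]
      rfl
    rw [← h2, hw, rankOneSelf_apply]
  constructor
  · rw [hsum, rankOneSelf_smul, hwf, one_pow, one_smul ℝ (rankOneSelf w), hw]
  · have h3 : inner ℂ f (f + crossMap φ e f x) = 1 := by
      rw [hsum, inner_smul_right, ← inner_conj_symm f w, mul_conj, normSq_eq_norm_sq, hwf]
      norm_num
    rw [inner_add_right, hff] at h3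
    simpa using h3

lemma inner_crossMap (hx : inner ℂ e x = 0) (hy : inner ℂ e y = 0) :
    (inner ℂ (crossMap φ e f x) (crossMap φ e f y)).re = (inner ℂ x y).re ∧
      ‖inner ℂ (crossMap φ e f x) (crossMap φ e f y)‖ = ‖inner ℂ x y‖ := by
  have hf : ‖f‖ = 1 := (hφ.norm_eq hef).trans he
  have hff : inner ℂ f f = 1 := by simp [inner_self_eq_norm_sq_to_K, hf]
  have hee : inner ℂ e e = 1 := by simp [inner_self_eq_norm_sq_to_K, he]
  have key {x : H} (hx : inner ℂ e x = 0) :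
      ‖1 + inner ℂ (crossMap φ e f x) (crossMap φ e f y)‖ = ‖1 + inner ℂ x y‖ := by
    obtain ⟨h1, h2⟩ := hφ.map_rankOneSelf_add_and_inner_crossMap he hef hx
    obtain ⟨h3, h4⟩ := hφ.map_rankOneSelf_add_and_inner_crossMap he hef hy
    have := hφ.norm_inner_eq h1 h3
    simpa only [inner_add_left, inner_add_right, hff, hee, h4, hy, inner_eq_zero_symm.mp h2,
      inner_eq_zero_symm.mp hx, add_zero, zero_add] using this
  have h1 := key hx
  have h2 := key (x := -x) (by rw [inner_neg_right, hx, neg_zero])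
  rw [map_neg, inner_neg_left, inner_neg_left] at h2
  set z := inner ℂ (crossMap φ e f x) (crossMap φ e f y)
  set z' := inner ℂ x y
  have h1' := congrArg (· ^ 2) h1
  have h2' := congrArg (· ^ 2) h2
  simp only [← normSq_eq_norm_sq, normSq_apply, add_re, add_im, neg_re, neg_im, one_re,
    one_im] at h1' h2'
  constructor
  · nlinarith
  · rw [← sq_eq_sq₀ (norm_nonneg _) (norm_nonneg _), ← normSq_eq_norm_sq, ← normSq_eq_norm_sq,
      normSq_apply, normSq_apply]
    nlinarith

lemma crossMap_I_smul (hx : inner ℂ e x = 0) :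
    crossMap φ e f (I • x) = I • crossMap φ e f x ∨
      crossMap φ e f (I • x) = -(I • crossMap φ e f x) := by
  have hIx : inner ℂ e (I • x) = 0 := by rw [inner_smul_right, hx, mul_zero]
  have hnorm {y : H} (hy : inner ℂ e y = 0) : ‖crossMap φ e f y‖ = ‖y‖ := by
    have := (hφ.inner_crossMap he hef hy hy).2
    rw [inner_self_eq_norm_sq_to_K, inner_self_eq_norm_sq_to_K] at this
    simpa using this
  obtain ⟨hre, hn⟩ := hφ.inner_crossMap he hef hx hIx
  have h1 : inner ℂ x (I • x) = ((‖x‖ ^ 2 : ℝ) : ℂ) * I := by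
    rw [inner_smul_right, inner_self_eq_norm_sq_to_K, mul_comm]
    norm_num
  have hnx := hnorm hx
  have hnIx := hnorm hIx
  rw [norm_smul, norm_I, one_mul] at hnIx
  set a := crossMap φ e f x with ha
  set b := crossMap φ e f (I • x) with hb
  have him : (inner ℂ a b).im = ‖x‖ ^ 2 ∨ (inner ℂ a b).im = -‖x‖ ^ 2 := by
    rw [h1, re_ofReal_mul, I_re, mul_zero] at hre
    rw [h1, norm_mul, norm_I, mul_one, norm_real, norm_pow, norm_norm] at hn
    have h2 := congrArg (· ^ 2) hn
    simp only [← normSq_eq_norm_sq, normSq_apply, hre] at h2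
    exact sq_eq_sq_iff_eq_or_eq_neg.mp (by linarith)
  have hcross : (inner ℂ b (I • a)).re = (inner ℂ a b).im := by
    rw [inner_smul_right, ← inner_conj_symm b a, mul_re, conj_re, conj_im, I_re, I_im]
    ring
  have hnIa : ‖I • a‖ = ‖x‖ := by rw [norm_smul, norm_I, one_mul, hnx]
  rcases him with him | him
  · left
    have := norm_sub_sq (𝕜 := ℂ) b (I • a)
    rw [RCLike.re_eq_complex_re, hcross, him, hnIx, hnIa] at this
    rw [← sub_eq_zero, ← norm_eq_zero, ← sq_eq_zero_iff]
    linarith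
  · right
    have := norm_add_sq (𝕜 := ℂ) b (I • a)
    rw [RCLike.re_eq_complex_re, hcross, him, hnIx, hnIa] at this
    rw [← add_eq_zero_iff_eq_neg, ← norm_eq_zero, ← sq_eq_zero_iff]
    linarith

end

end PreservesRankOne

/-- A semilinear map implementing `φ` on the rank one positive operators is a semilinear isometry
equivalence implementing `φ`. -/
lemma PreservesRankOne.exists_eq_conj_of_semilinear (hφ : PreservesRankOne φ) {σ : ℂ →+* ℂ}
    [RingHomInvPair σ σ] (U : H →ₛₗ[σ] H) (hU : ∀ v, φ (rankOneSelf v) = rankOneSelf (U v)) :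
    ∃ V : H ≃ₛₗᵢ[σ] H, ∀ (A : selfAdjoint (H →L[ℂ] H)) (x : H),
      (φ A : H →L[ℂ] H) x = V ((A : H →L[ℂ] H) (V.symm x)) := by
  have hnorm (v : H) : ‖U v‖ = ‖v‖ := hφ.norm_eq (hU v)
  have hsurj : Function.Surjective U := fun w => by
    obtain ⟨x, hx⟩ := hφ.exists_eq_map w
    obtain ⟨c, hc⟩ := exists_smul_of_rankOneSelf_eq (hx.symm.trans (hU x))
    exact ⟨σ c • x, by rw [U.map_smulₛₗ, RingHomInvPair.comp_apply_eq, hc]⟩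
  have hre (x y : H) : (inner ℂ (U x) (U y)).re = (inner ℂ x y).re := by
    have h (a b : H) := re_inner_eq_norm_add_mul_self_sub_norm_mul_self_sub_norm_mul_self_div_two
      (𝕜 := ℂ) a b
    simp only [RCLike.re_eq_complex_re] at h
    rw [h, h, ← map_add, hnorm, hnorm, hnorm]
  have hinner (A : selfAdjoint (H →L[ℂ] H)) (v : H) :
      inner ℂ (U ((A : H →L[ℂ] H) v)) (U v) = (quadForm A v : ℂ) := by
    have h1 : (inner ℂ (U ((A : H →L[ℂ] H) v)) (U v)).re = quadForm A v := hre _ _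
    have h2 : ‖inner ℂ (U ((A : H →L[ℂ] H) v)) (U v)‖ = |quadForm A v| := by
      rw [hφ.norm_inner_eq (hU _) (hU _), ← ofReal_quadForm, norm_real, Real.norm_eq_abs]
    rw [← h1] at h2 ⊢
    exact Complex.ext rfl (abs_re_eq_norm.mp h2.symm)
  let V : H ≃ₛₗᵢ[σ] H := LinearIsometryEquiv.ofSurjective ⟨U, hnorm⟩ hsurj
  refine ⟨V, fun A x => ?_⟩
  let T : H →ₗ[ℂ] H :=
    { toFun x := V ((A : H →L[ℂ] H) (V.symm x))
      map_add' x y := by simp only [map_add]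
      map_smul' c x := by
        simp only [map_smulₛₗ, RingHomInvPair.comp_apply_eq, RingHom.id_apply] }
  have hT : ((φ A : H →L[ℂ] H) : H →ₗ[ℂ] H) = T := by
    refine (ext_inner_map _ _).mp fun x => ?_
    obtain ⟨v, rfl⟩ := hsurj x
    have h1 : T (U v) = U ((A : H →L[ℂ] H) v) :=
      congrArg (fun y => V ((A : H →L[ℂ] H) y)) (V.symm_apply_apply v)
    rw [h1, hinner, ← hφ.quadForm_map (hU v)]
    exact (ofReal_quadForm _ _).symm
  exact LinearMap.congr_fun hT x

/-- The orthogonal projection onto the complement of the unit vector `e`. -/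
noncomputable def orthComplProj (e : H) : H →ₗ[ℂ] H :=
  ((1 - (rankOneSelf e : H →L[ℂ] H) : H →L[ℂ] H) : H →ₗ[ℂ] H)

lemma orthComplProj_apply (e x : H) : orthComplProj e x = x - inner ℂ e x • e := rfl

lemma inner_orthComplProj (he : ‖e‖ = 1) (x : H) : inner ℂ e (orthComplProj e x) = 0 := by
  rw [orthComplProj_apply, inner_sub_right, inner_smul_right, inner_self_eq_norm_sq_to_K, he]
  simp

namespace PreservesRankOne

variable (hφ : PreservesRankOne φ)
include hφ

lemma map_rankOneSelf_smul_add {σ : ℂ →+* ℂ} (hσ : ∀ c, ‖σ c‖ = ‖c‖)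
    (he : ‖e‖ = 1) (hef : φ (rankOneSelf e) = rankOneSelf f)
    (hsmul : ∀ (c : ℂ) (x : H), inner ℂ e x = 0 →
      crossMap φ e f (c • x) = σ c • crossMap φ e f x)
    (a : ℂ) (hx : inner ℂ e x = 0) :
    φ (rankOneSelf (a • e + x)) = rankOneSelf (σ a • f + crossMap φ e f x) := by
  rcases eq_or_ne a 0 with rfl | ha
  · have hx' : inner ℂ e (-x) = 0 := by rw [inner_neg_right, hx, neg_zero]
    have h1 := congrArg φ (rankOneSelf_add_add_sub e x)
    rw [φ.map_add, φ.map_add, φ.map_smul, φ.map_smul, hef, sub_eq_add_neg,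
      (hφ.map_rankOneSelf_add_and_inner_crossMap he hef hx).1,
      (hφ.map_rankOneSelf_add_and_inner_crossMap he hef hx').1, map_neg, ← sub_eq_add_neg,
      rankOneSelf_add_add_sub] at h1
    rw [map_zero, zero_smul, zero_smul, zero_add, zero_add]
    refine quadForm_ext fun y => ?_
    have h2 := congrArg (quadForm · y) h1
    simp only [quadForm_add, quadForm_smul] at h2
    linarith
  · have hx' : inner ℂ e (a⁻¹ • x) = 0 := by rw [inner_smul_right, hx, mul_zero]
    have h1 : a • e + x = a • (e + a⁻¹ • x) := by
      rw [smul_add, smul_inv_smul₀ ha]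
    have ha' : σ a ≠ 0 := by rwa [← norm_ne_zero_iff, hσ, norm_ne_zero_iff]
    rw [h1, rankOneSelf_smul, φ.map_smul,
      (hφ.map_rankOneSelf_add_and_inner_crossMap he hef hx').1, hsmul _ _ hx, ← hσ a,
      ← rankOneSelf_smul, smul_add, map_inv₀, smul_inv_smul₀ ha']

lemma exists_eq_conj_of_crossMap {σ : ℂ →+* ℂ} [RingHomInvPair σ σ] (hσ : ∀ c, ‖σ c‖ = ‖c‖)
    (hσr : ∀ r : ℝ, σ r = r) (he : ‖e‖ = 1) (hef : φ (rankOneSelf e) = rankOneSelf f)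
    (hI : ∀ x, inner ℂ e x = 0 → crossMap φ e f (I • x) = σ I • crossMap φ e f x) :
    ∃ V : H ≃ₛₗᵢ[σ] H, ∀ (A : selfAdjoint (H →L[ℂ] H)) (x : H),
      (φ A : H →L[ℂ] H) x = V ((A : H →L[ℂ] H) (V.symm x)) := by
  have hsmul (c : ℂ) (x : H) (hx : inner ℂ e x = 0) :
      crossMap φ e f (c • x) = σ c • crossMap φ e f x := by
    conv_lhs => rw [← re_add_im c, add_smul, mul_smul, Complex.coe_smul, Complex.coe_smul]
    rw [map_add, map_smul, map_smul, hI x hx]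
    conv_rhs => rw [← re_add_im c, map_add, map_mul, hσr, hσr, add_smul, mul_smul,
      Complex.coe_smul, Complex.coe_smul]
  let U : H →ₛₗ[σ] H :=
    { toFun x := σ (inner ℂ e x) • f + crossMap φ e f (orthComplProj e x)
      map_add' x y := by
        rw [inner_add_right, map_add, map_add, map_add, add_smul]
        abel
      map_smul' c x := by
        rw [inner_smul_right, map_mul, map_smul, hsmul _ _ (inner_orthComplProj he x), mul_smul,
          smul_add] }
  refine hφ.exists_eq_conj_of_semilinear U fun v => ?_
  have hv : inner ℂ e v • e + orthComplProj e v = v := by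
    rw [orthComplProj_apply, add_sub_cancel]
  conv_lhs => rw [← hv]
  exact hφ.map_rankOneSelf_smul_add hσ he hef hsmul _ (inner_orthComplProj he v)

/-- Wigner's theorem. -/
lemma exists_eq_conj [Nontrivial H] :
    (∃ V : H ≃ₗᵢ[ℂ] H, ∀ (A : selfAdjoint (H →L[ℂ] H)) (x : H),
      (φ A : H →L[ℂ] H) x = V ((A : H →L[ℂ] H) (V.symm x))) ∨
    ∃ V : H ≃ₛₗᵢ[starRingEnd ℂ] H, ∀ (A : selfAdjoint (H →L[ℂ] H)) (x : H),
      (φ A : H →L[ℂ] H) x = V ((A : H →L[ℂ] H) (V.symm x)) := by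
  obtain ⟨e, he⟩ := exists_norm_eq H zero_le_one
  obtain ⟨f, hef⟩ := hφ.exists_map_eq e
  let R : H →+ H := (crossMap φ e f).toAddMonoidHom.comp (orthComplProj e).toAddMonoidHom
  have hRx (x : H) : R x = crossMap φ e f (orthComplProj e x) := rfl
  have hR {x : H} (hx : inner ℂ e x = 0) : R x = crossMap φ e f x := by
    rw [hRx, orthComplProj_apply, hx, zero_smul, sub_zero]
  have hRI (x : H) : R (I • x) = crossMap φ e f (I • orthComplProj e x) := by
    rw [hRx, map_smul]
  rcases AddMonoidHom.eq_or_eq_neg_of_forall (R.comp (DistribSMul.toAddMonoidHom H I))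
    ((DistribSMul.toAddMonoidHom H I).comp R) (fun x => by
      simpa only [AddMonoidHom.comp_apply, DistribSMul.toAddMonoidHom_apply, hRI, hRx] using
        hφ.crossMap_I_smul he hef (inner_orthComplProj he x)) with h | h
  · left
    refine hφ.exists_eq_conj_of_crossMap (fun _ => rfl) (fun _ => rfl) he hef fun x hx => ?_
    have hIx : inner ℂ e (I • x) = 0 := by rw [inner_smul_right, hx, mul_zero]
    rw [← hR hx, ← hR hIx]
    exact DFunLike.congr_fun h x
  · right
    refine hφ.exists_eq_conj_of_crossMap norm_conj conj_ofReal he hef fun x hx => ?_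
    have hIx : inner ℂ e (I • x) = 0 := by rw [inner_smul_right, hx, mul_zero]
    rw [← hR hx, ← hR hIx, conj_I, neg_smul]
    exact DFunLike.congr_fun h x

end PreservesRankOne

end selfAdjoint

theorem norm_preserving_linear_bijection_selfadjoint
    (φ : selfAdjoint (H →L[ℂ] H) →ₗ[ℝ] selfAdjoint (H →L[ℂ] H))
    (hbij : Function.Bijective φ)
    (hnorm : ∀ A : selfAdjoint (H →L[ℂ] H), ‖(φ A : H →L[ℂ] H)‖ = ‖(A : H →L[ℂ] H)‖) :
    (∃ U : H ≃ₗᵢ[ℂ] H,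
        (∀ (A : selfAdjoint (H →L[ℂ] H)) (x : H),
            (φ A : H →L[ℂ] H) x = U ((A : H →L[ℂ] H) (U.symm x))) ∨
        (∀ (A : selfAdjoint (H →L[ℂ] H)) (x : H),
            (φ A : H →L[ℂ] H) x = -U ((A : H →L[ℂ] H) (U.symm x)))) ∨
    (∃ U : H ≃ₛₗᵢ[starRingEnd ℂ] H,
        (∀ (A : selfAdjoint (H →L[ℂ] H)) (x : H),
            (φ A : H →L[ℂ] H) x = U ((A : H →L[ℂ] H) (U.symm x))) ∨
        (∀ (A : selfAdjoint (H →L[ℂ] H)) (x : H),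
            (φ A : H →L[ℂ] H) x = -U ((A : H →L[ℂ] H) (U.symm x)))) := by
  cases subsingleton_or_nontrivial H with
  | inl _ => exact .inl ⟨.refl ℂ H, .inl fun _ _ => Subsingleton.elim _ _⟩
  | inr _ =>
    let ψ := LinearEquiv.ofBijective φ hbij
    rcases selfAdjoint.map_one_eq_one_or_neg_one (φ := ψ) hnorm with h1 | h1
    · exact (selfAdjoint.PreservesRankOne.of_norm_map (φ := ψ) hnorm h1).exists_eq_conj.imp
        (fun ⟨U, hU⟩ => ⟨U, .inl hU⟩) (fun ⟨U, hU⟩ => ⟨U, .inl hU⟩)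
    · let χ := ψ.trans (LinearEquiv.neg ℝ)
      have hχ (A : selfAdjoint (H →L[ℂ] H)) : χ A = -φ A := rfl
      have hχn (A : selfAdjoint (H →L[ℂ] H)) : ‖(χ A : H →L[ℂ] H)‖ = ‖(A : H →L[ℂ] H)‖ := by
        rw [hχ, AddSubgroup.coe_neg, norm_neg, hnorm]
      have hχ1 : χ 1 = 1 := (congrArg Neg.neg h1).trans (neg_neg 1)
      have key {x y : H} {A : selfAdjoint (H →L[ℂ] H)} (h : (χ A : H →L[ℂ] H) x = y) :
          (φ A : H →L[ℂ] H) x = -y := by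
        rw [← h, hχ, AddSubgroup.coe_neg, neg_apply, neg_neg]
      exact (selfAdjoint.PreservesRankOne.of_norm_map hχn hχ1).exists_eq_conj.imp
        (fun ⟨U, hU⟩ => ⟨U, .inr fun A x => key (hU A x)⟩)
        (fun ⟨U, hU⟩ => ⟨U, .inr fun A x => key (hU A x)⟩)
end
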